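/- arXiv:2406.11692 — 2 statements merged into one kernel-verified Lean document; each statement's English description precedes it below -/
import Mathlib

section
/- For every β ∈ Sym(V×V,W), every c ∈ ℝ and every λ ∈ [0,1), the inequality ρ_c(β) ≤ c + H_β² − λ·ρ⊥(β) holds; moreover, equality holds for some λ ∈ [0,1) if and only if β is umbilical. -/
open scoped RealInnerProductSpace BigOperators
open MeasureTheory Classical

namespace Paper

variable {V W : Type*} [NormedAddCommGroup V] [InnerProductSpace ℝ V]
  [NormedAddCommGroup W] [InnerProductSpace ℝ W]

/-- `β` is a symmetric bilinear map. -/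
def IsSymmBil (β : V →ₗ[ℝ] V →ₗ[ℝ] W) : Prop := ∀ x y, β x y = β y x

/-- The formal shape operator `A_ξ(β)`, determined by `⟪β x y, ξ⟫ = ⟪A_ξ(β) x, y⟫`. -/
noncomputable def shapeOp (β : V →ₗ[ℝ] V →ₗ[ℝ] W) (ξ : W) : V →ₗ[ℝ] V :=
  if h : ∃ A : V →ₗ[ℝ] V, ∀ x y : V, ⟪β x y, ξ⟫ = ⟪A x, y⟫ then h.choose else 0

variable {n m : ℕ}

/-- The mean curvature vector `𝓗_β = (1/n) Σ_i β(e_i, e_i)`. -/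
noncomputable def meanCurv (e : OrthonormalBasis (Fin n) ℝ V)
    (β : V →ₗ[ℝ] V →ₗ[ℝ] W) : W :=
  (n : ℝ)⁻¹ • ∑ i, β (e i) (e i)

/-- The formal Ricci tensor `Ric_c(β)`. -/
noncomputable def ric (c : ℝ) (e : OrthonormalBasis (Fin n) ℝ V)
    (β : V →ₗ[ℝ] V →ₗ[ℝ] W) (x y : V) : ℝ :=
  c * (n - 1) * ⟪x, y⟫ + n * ⟪meanCurv e β, β x y⟫
    - ∑ i, ⟪β x (e i), β y (e i)⟫

/-- The normalized scalar curvature `ρ_c(β) = (1/(n(n-1))) tr Ric_c(β)`. -/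
noncomputable def rho (c : ℝ) (e : OrthonormalBasis (Fin n) ℝ V)
    (β : V →ₗ[ℝ] V →ₗ[ℝ] W) : ℝ :=
  (n * (n - 1) : ℝ)⁻¹ * ∑ i, ric c e β (e i) (e i)

/-- The self-adjoint operator `T_c(β)` with `⟪T_c(β) x, y⟫ = (1/(n-1)) Ric_c(β)(x,y)`. -/
noncomputable def ricOp (c : ℝ) (e : OrthonormalBasis (Fin n) ℝ V)
    (β : V →ₗ[ℝ] V →ₗ[ℝ] W) : V →ₗ[ℝ] V :=
  if h : ∃ T : V →ₗ[ℝ] V, ∀ x y : V, ⟪T x, y⟫ = (n - 1 : ℝ)⁻¹ * ric c e β x y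
  then h.choose else 0

/-- The increasingly ordered eigenvalues of an endomorphism admitting an orthonormal
eigenbasis (junk value otherwise). -/
noncomputable def sortedEigs (n : ℕ) (T : V →ₗ[ℝ] V) : Fin n → ℝ :=
  if h : ∃ μ : Fin n → ℝ, Monotone μ ∧
      ∃ b : OrthonormalBasis (Fin n) ℝ V, ∀ i, T (b i) = μ i • b i
  then h.choose else fun _ => 0

/-- The `k`-th scalar curvature `ρ_{c,k}(β) = (1/k) Σ_{i=1}^k λ_{c,i}(β)`. -/
noncomputable def rhoK (c : ℝ) (k : ℕ) (e : OrthonormalBasis (Fin n) ℝ V)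
    (β : V →ₗ[ℝ] V →ₗ[ℝ] W) : ℝ :=
  (k : ℝ)⁻¹ * ∑ i ∈ Finset.univ.filter (fun i : Fin n => (i : ℕ) < k),
    sortedEigs n (ricOp c e β) i

/-- The normal scalar curvature `ρ⊥(β)`. -/
noncomputable def rhoPerp (e : OrthonormalBasis (Fin n) ℝ V)
    (ξ : OrthonormalBasis (Fin m) ℝ W) (β : V →ₗ[ℝ] V →ₗ[ℝ] W) : ℝ :=
  (n * (n - 1) : ℝ)⁻¹ * Real.sqrt (∑ a, ∑ b, ∑ i,
    ‖(shapeOp β (ξ a) ∘ₗ shapeOp β (ξ b) - shapeOp β (ξ b) ∘ₗ shapeOp β (ξ a)) (e i)‖ ^ 2)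

/-- The index of a self-adjoint endomorphism: the number of negative eigenvalues,
counted with multiplicity. -/
noncomputable def negIndex (n : ℕ) (T : V →ₗ[ℝ] V) : ℕ :=
  (Finset.univ.filter (fun i : Fin n => sortedEigs n T i < 0)).card

/-- The Hilbert–Schmidt norm `‖β‖² = Σ_{i,j} ‖β(e_i,e_j)‖²`. -/
noncomputable def normHS (e : OrthonormalBasis (Fin n) ℝ V)
    (β : V →ₗ[ℝ] V →ₗ[ℝ] W) : ℝ :=
  Real.sqrt (∑ i, ∑ j, ‖β (e i) (e j)‖ ^ 2)

/-- `ψ_p(β) = ∫_{Λ_p(β)} |det A_u(β)| dS_u` over the unit sphere of `W = ℝ^m`. -/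
noncomputable def psi (n m p : ℕ)
    (β : EuclideanSpace ℝ (Fin n) →ₗ[ℝ] EuclideanSpace ℝ (Fin n) →ₗ[ℝ]
      EuclideanSpace ℝ (Fin m)) : ℝ :=
  ∫ u in {u : Metric.sphere (0 : EuclideanSpace ℝ (Fin m)) 1 |
      p < negIndex n (shapeOp β (u : EuclideanSpace ℝ (Fin m))) ∧
      negIndex n (shapeOp β (u : EuclideanSpace ℝ (Fin m))) < n - p},
    |LinearMap.det (shapeOp β (u : EuclideanSpace ℝ (Fin m)))|
    ∂((volume : Measure (EuclideanSpace ℝ (Fin m))).toSphere)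


section
variable {ι : Type*} [Fintype ι]

/-- Two pairs of indices whose entries are far apart share an index. -/
theorem exists_common_index (l : ι → ℝ) (p q : ι) (hpq : ∑ i, l i ^ 2 < (l p - l q) ^ 2) :
    ∃ c, ∀ r s, ∑ i, l i ^ 2 < (l r - l s) ^ 2 → r = c ∨ s = c := by
  have hsub : ∀ s : Finset ι, ∑ i ∈ s, l i ^ 2 ≤ ∑ i, l i ^ 2 := fun s =>
    Finset.sum_le_sum_of_subset_of_nonneg (Finset.subset_univ s) fun i _ _ => sq_nonneg (l i)
  have h0 : 0 ≤ ∑ i, l i ^ 2 := Finset.sum_nonneg fun i _ => sq_nonneg (l i)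
  set t := ∑ i, l i ^ 2
  have hne : ∀ r s, t < (l r - l s) ^ 2 → r ≠ s := by
    rintro r s h rfl
    simp at h
    linarith
  have hmeet : ∀ a b r s, t < (l a - l b) ^ 2 → t < (l r - l s) ^ 2 →
      r = a ∨ r = b ∨ s = a ∨ s = b := by
    intro a b r s hab hrs
    by_contra! h
    obtain ⟨h1, h2, h3, h4⟩ := h
    have := hsub {a, b, r, s}
    rw [Finset.sum_insert (by simp [hne a b hab, h1.symm, h3.symm]),
      Finset.sum_insert (by simp [h2.symm, h4.symm]), Finset.sum_pair (hne r s hrs)] at this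
    nlinarith [sq_nonneg (l a + l b), sq_nonneg (l r + l s)]
  have htri : ∀ a b r, t < (l a - l b) ^ 2 → t < (l b - l r) ^ 2 → t < (l a - l r) ^ 2 →
      False := by
    intro a b r hab hbr har
    have := hsub {a, b, r}
    rw [Finset.sum_insert (by simp [hne a b hab, hne a r har]),
      Finset.sum_pair (hne b r hbr)] at this
    nlinarith [sq_nonneg (l a + l b + l r)]
  have hsymm : ∀ r s, t < (l r - l s) ^ 2 → t < (l s - l r) ^ 2 := by
    intro r s h
    rwa [← neg_sub, neg_sq]
  by_cases hp : ∀ r s, t < (l r - l s) ^ 2 → r = p ∨ s = p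
  · exact ⟨p, hp⟩
  · push Not at hp
    obtain ⟨r, s, hrs, hrp, hsp⟩ := hp
    obtain ⟨v, hqv, hvp⟩ : ∃ v, t < (l q - l v) ^ 2 ∧ v ≠ p := by
      rcases hmeet p q r s hpq hrs with h | h | h | h
      · exact absurd h hrp
      · exact ⟨s, h ▸ hrs, hsp⟩
      · exact absurd h hsp
      · exact ⟨r, h ▸ hsymm _ _ hrs, hrp⟩
    refine ⟨q, fun a b hab => ?_⟩
    by_contra! h
    have hpv : t < (l p - l v) ^ 2 := by
      rcases hmeet p q a b hpq hab with h1 | h1 | h1 | h1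
      · rcases hmeet q v a b hqv hab with h2 | h2 | h2 | h2
        · exact absurd h2 h.1
        · exact absurd (h2.symm.trans h1) hvp
        · exact absurd h2 h.2
        · rwa [← h1, ← h2]
      · exact absurd h1 h.1
      · rcases hmeet q v a b hqv hab with h2 | h2 | h2 | h2
        · exact absurd h2 h.1
        · rw [← h1, ← h2]
          exact hsymm _ _ hab
        · exact absurd h2 h.2
        · exact absurd (h2.symm.trans h1) hvp
      · exact absurd h1 h.2
    exact htri p q v hpq hqv hpv

theorem sum_posPart_sq_sub_le (l : ι → ℝ) (c : ι) :
    ∑ q, max ((l c - l q) ^ 2 - ∑ i, l i ^ 2) 0 ≤ ∑ i, l i ^ 2 := by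
  have h0 : 0 ≤ ∑ i, l i ^ 2 := Finset.sum_nonneg fun i _ => sq_nonneg (l i)
  have hsub : ∀ s : Finset ι, ∑ i ∈ s, l i ^ 2 ≤ ∑ i, l i ^ 2 := fun s =>
    Finset.sum_le_sum_of_subset_of_nonneg (Finset.subset_univ s) fun i _ _ => sq_nonneg (l i)
  set t := ∑ i, l i ^ 2
  set J := Finset.univ.filter fun q => 0 < (l c - l q) ^ 2 - t with hJ
  have hcJ : c ∉ J := by simp [hJ, h0]
  have hsum : ∑ q, max ((l c - l q) ^ 2 - t) 0 = ∑ q ∈ J, ((l c - l q) ^ 2 - t) := by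
    rw [hJ, Finset.sum_filter]
    refine Finset.sum_congr rfl fun q _ => ?_
    split_ifs with h
    · exact max_eq_left h.le
    · exact max_eq_right (not_lt.mp h)
  have hins := hsub (insert c J)
  rw [Finset.sum_insert hcJ] at hins
  have hcs := sq_sum_le_card_mul_sum_sq (s := J) (f := l)
  have hexp : ∑ q ∈ J, ((l c - l q) ^ 2 - t)
      = J.card * (l c ^ 2 - t) - 2 * l c * ∑ q ∈ J, l q + ∑ q ∈ J, l q ^ 2 := by
    rw [Finset.mul_sum, ← nsmul_eq_mul, ← Finset.sum_const, ← Finset.sum_sub_distrib,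
      ← Finset.sum_add_distrib]
    exact Finset.sum_congr rfl fun q _ => by ring
  rw [hsum, hexp]
  have hk : (0 : ℝ) ≤ J.card := Nat.cast_nonneg _
  nlinarith [sq_nonneg (l c + ∑ q ∈ J, l q), mul_le_mul_of_nonneg_left hins hk]

theorem sum_weighted_sq_sub_le (l : ι → ℝ) (y : ι → ι → ℝ) (τ : ℝ) (hτ : 0 ≤ τ)
    (hy0 : ∀ p q, 0 ≤ y p q) (hy : ∀ p q, p ≠ q → 2 * y p q ≤ τ) :
    ∑ p, ∑ q, y p q * (l p - l q) ^ 2 ≤ (∑ i, l i ^ 2) * (∑ p, ∑ q, y p q + τ) := by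
  have h0 : 0 ≤ ∑ i, l i ^ 2 := Finset.sum_nonneg fun i _ => sq_nonneg (l i)
  suffices h : ∑ p, ∑ q, y p q * ((l p - l q) ^ 2 - ∑ i, l i ^ 2) ≤ τ * ∑ i, l i ^ 2 by
    simp only [mul_sub, Finset.sum_sub_distrib, ← Finset.sum_mul] at h
    linarith
  by_cases hE : ∃ p q, ∑ i, l i ^ 2 < (l p - l q) ^ 2
  · obtain ⟨p, q, hpq⟩ := hE
    obtain ⟨c, hc⟩ := exists_common_index l p q hpq
    have hmax := sum_posPart_sq_sub_le l c
    set t := ∑ i, l i ^ 2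
    have hterm : ∀ r s, y r s * ((l r - l s) ^ 2 - t) ≤
        (if r = c then τ / 2 * max ((l c - l s) ^ 2 - t) 0 else 0) +
        (if s = c then τ / 2 * max ((l c - l r) ^ 2 - t) 0 else 0) := by
      intro r s
      have hnn : ∀ x : ℝ, 0 ≤ τ / 2 * max x 0 := fun x => by positivity
      by_cases hrs : t < (l r - l s) ^ 2
      · have hne : r ≠ s := by
          rintro rfl
          simp at hrs
          linarith
        have hle : y r s * ((l r - l s) ^ 2 - t) ≤ τ / 2 * max ((l r - l s) ^ 2 - t) 0 :=
          mul_le_mul (by linarith [hy r s hne]) (le_max_left _ _) (by linarith) (by linarith)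
        rcases hc r s hrs with rfl | rfl
        · rw [if_pos rfl]
          refine hle.trans (le_add_of_nonneg_right ?_)
          split_ifs <;> simp [hnn]
        · rw [if_pos rfl, sub_sq_comm (l s) (l r)]
          refine hle.trans (le_add_of_nonneg_left ?_)
          split_ifs <;> simp [hnn]
      · refine (mul_nonpos_of_nonneg_of_nonpos (hy0 r s) (by linarith)).trans ?_
        refine add_nonneg ?_ ?_ <;> split_ifs <;> simp [hnn]
    refine (Finset.sum_le_sum fun r _ => Finset.sum_le_sum fun s _ => hterm r s).trans ?_
    simp only [Finset.sum_add_distrib, Finset.sum_ite_eq', Finset.mem_univ, if_true]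
    rw [Finset.sum_comm]
    simp only [Finset.sum_ite_eq', Finset.mem_univ, if_true, ← Finset.mul_sum]
    nlinarith
  · push Not at hE
    refine le_trans ?_ (mul_nonneg hτ h0)
    exact Finset.sum_nonpos fun p _ => Finset.sum_nonpos fun q _ =>
      mul_nonpos_of_nonneg_of_nonpos (hy0 p q) (by linarith [hE p q])
end

section
variable {ι κ : Type*} [Fintype ι] [Fintype κ]

open Matrix in
theorem sum_mul_eq_trace (X Y : Matrix ι ι ℝ) :
    ∑ i, ∑ j, X i j * Y i j = (X * Yᵀ).trace := by
  simp [Matrix.trace, Matrix.mul_apply]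

open Matrix in
theorem sum_commutator_diagonal_le (l : ι → ℝ) (Y : κ → Matrix ι ι ℝ)
    (hY : ∀ b, (Y b)ᵀ = Y b) (τ : ℝ) (hτ : 0 ≤ τ)
    (h : ∀ Z : Matrix ι ι ℝ, Zᵀ = Z →
      ∑ b, (∑ i, ∑ j, Y b i j * Z i j) ^ 2 ≤ τ * ∑ i, ∑ j, Z i j ^ 2) :
    ∑ b, ∑ i, ∑ j, (diagonal l * Y b - Y b * diagonal l) i j ^ 2 ≤
      (∑ i, l i ^ 2) * (∑ b, ∑ i, ∑ j, Y b i j ^ 2 + τ) := by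
  have hw := sum_weighted_sq_sub_le l (fun p q => ∑ b, Y b p q ^ 2) τ hτ
    (fun p q => Finset.sum_nonneg fun b _ => sq_nonneg _) ?_
  · have hswap : ∀ f : κ → ι → ι → ℝ, ∑ b, ∑ i, ∑ j, f b i j = ∑ i, ∑ j, ∑ b, f b i j := by
      intro f
      rw [Finset.sum_comm]
      exact Finset.sum_congr rfl fun i _ => Finset.sum_comm
    rw [hswap, hswap]
    refine le_of_eq_of_le ?_ hw
    refine Finset.sum_congr rfl fun i _ => Finset.sum_congr rfl fun j _ => ?_
    rw [Finset.sum_mul]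
    refine Finset.sum_congr rfl fun b _ => ?_
    rw [Matrix.sub_apply, diagonal_mul, mul_diagonal]
    ring
  · intro p q hpq
    have hZ := h (Matrix.single p q 1 + Matrix.single q p 1) (by
      rw [transpose_add, transpose_single, transpose_single, add_comm])
    have h1 : ∀ X : Matrix ι ι ℝ, ∑ i, ∑ j, X i j *
        (Matrix.single p q (1 : ℝ) + Matrix.single q p 1 : Matrix ι ι ℝ) i j = X p q + X q p := by
      intro X
      simp [Matrix.single_apply, mul_add, Finset.sum_add_distrib, ite_and]
    have h2 := h1 (Matrix.single p q (1 : ℝ) + Matrix.single q p 1 : Matrix ι ι ℝ)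
    simp only [← sq] at h2
    simp only [h1, h2] at hZ
    have hs : ∀ b, Y b q p = Y b p q := fun b => congrFun (congrFun (hY b) p) q
    simp only [hs, Matrix.add_apply, Matrix.single_apply, hpq, hpq.symm, and_self, if_true,
      if_false] at hZ
    have h3 : ∑ b, (Y b p q + Y b p q) ^ 2 = 4 * ∑ b, Y b p q ^ 2 := by
      rw [Finset.mul_sum]
      exact Finset.sum_congr rfl fun b _ => by ring
    linarith

open Matrix in
theorem sum_mul_conj (U : Matrix ι ι ℝ) (hU : U * Uᵀ = 1) (X Y : Matrix ι ι ℝ) :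
    ∑ i, ∑ j, (Uᵀ * X * U) i j * (Uᵀ * Y * U) i j = ∑ i, ∑ j, X i j * Y i j := by
  have hmul : Uᵀ * X * U * (Uᵀ * Y * U)ᵀ = Uᵀ * (X * (U * Uᵀ) * Yᵀ * U) := by
    simp only [transpose_mul, transpose_transpose, Matrix.mul_assoc]
  rw [sum_mul_eq_trace, sum_mul_eq_trace, hmul, trace_mul_comm, Matrix.mul_assoc, hU, Matrix.mul_one,
    Matrix.mul_one]

open Matrix in
theorem sum_sq_conj (U : Matrix ι ι ℝ) (hU : U * Uᵀ = 1) (X : Matrix ι ι ℝ) :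
    ∑ i, ∑ j, (Uᵀ * X * U) i j ^ 2 = ∑ i, ∑ j, X i j ^ 2 := by
  simp only [sq, sum_mul_conj U hU]

open Matrix in
theorem sum_commutator_le (S : Matrix ι ι ℝ) (hS : Sᵀ = S) (Y : κ → Matrix ι ι ℝ)
    (hY : ∀ b, (Y b)ᵀ = Y b) (τ : ℝ) (hτ : 0 ≤ τ)
    (h : ∀ Z : Matrix ι ι ℝ, Zᵀ = Z →
      ∑ b, (∑ i, ∑ j, Y b i j * Z i j) ^ 2 ≤ τ * ∑ i, ∑ j, Z i j ^ 2) :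
    ∑ b, ∑ i, ∑ j, (S * Y b - Y b * S) i j ^ 2 ≤
      (∑ i, ∑ j, S i j ^ 2) * (∑ b, ∑ i, ∑ j, Y b i j ^ 2 + τ) := by
  have hH : S.IsHermitian := by
    rw [Matrix.IsHermitian, conjTranspose_eq_transpose_of_trivial, hS]
  obtain ⟨U, l, hU, hU', hSU⟩ : ∃ (U : Matrix ι ι ℝ) (l : ι → ℝ),
      U * Uᵀ = 1 ∧ Uᵀ * U = 1 ∧ Uᵀ * S * U = diagonal l := by
    have h1 : (hH.eigenvectorUnitary : Matrix ι ι ℝ) * (hH.eigenvectorUnitary : Matrix ι ι ℝ)ᵀ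
        = 1 := Unitary.coe_mul_star_self hH.eigenvectorUnitary
    have h2 : (hH.eigenvectorUnitary : Matrix ι ι ℝ)ᵀ * (hH.eigenvectorUnitary : Matrix ι ι ℝ)
        = 1 := Unitary.coe_star_mul_self hH.eigenvectorUnitary
    refine ⟨hH.eigenvectorUnitary, hH.eigenvalues, h1, h2, ?_⟩
    have h3 : S = (hH.eigenvectorUnitary : Matrix ι ι ℝ) * diagonal hH.eigenvalues *
        (hH.eigenvectorUnitary : Matrix ι ι ℝ)ᵀ := hH.spectral_theorem
    generalize (hH.eigenvectorUnitary : Matrix ι ι ℝ) = U at h1 h2 h3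
    generalize hH.eigenvalues = l at h3
    rw [h3]
    simp only [Matrix.mul_assoc, h2, Matrix.mul_one]
    rw [← Matrix.mul_assoc, h2, Matrix.one_mul]
  have hd := sum_commutator_diagonal_le l (fun b => Uᵀ * Y b * U)
    (fun b => by simp only [transpose_mul, transpose_transpose, hY, Matrix.mul_assoc]) τ hτ ?_
  · have hl : ∑ i, l i ^ 2 = ∑ i, ∑ j, S i j ^ 2 := by
      rw [← sum_sq_conj U hU, hSU]
      refine Finset.sum_congr rfl fun i _ => ?_
      simp [diagonal_apply, ite_pow]
    have hcomm : ∀ b, diagonal l * (Uᵀ * Y b * U) - Uᵀ * Y b * U * diagonal l =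
        Uᵀ * (S * Y b - Y b * S) * U := by
      intro b
      have hc : ∀ P Q : Matrix ι ι ℝ, Uᵀ * P * U * (Uᵀ * Q * U) = Uᵀ * (P * Q) * U := by
        intro P Q
        calc Uᵀ * P * U * (Uᵀ * Q * U) = Uᵀ * P * (U * Uᵀ) * Q * U := by
              simp only [Matrix.mul_assoc]
          _ = Uᵀ * (P * Q) * U := by rw [hU, Matrix.mul_one]; simp only [Matrix.mul_assoc]
      rw [← hSU, hc, hc, Matrix.mul_sub, Matrix.sub_mul]
    simpa only [hcomm, sum_sq_conj U hU, hl] using hd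
  · intro Z hZ
    have hZ' : Uᵀ * (U * Z * Uᵀ) * U = Z := by
      calc Uᵀ * (U * Z * Uᵀ) * U = (Uᵀ * U) * Z * (Uᵀ * U) := by simp only [Matrix.mul_assoc]
        _ = Z := by rw [hU', Matrix.one_mul, Matrix.mul_one]
    have := h (U * Z * Uᵀ) (by
      simp only [transpose_mul, transpose_transpose, hZ, Matrix.mul_assoc])
    rw [← sum_sq_conj U hU, hZ'] at this
    simp only [← sum_mul_conj U hU (Y _) (U * Z * Uᵀ), hZ'] at this
    exact this
end

theorem le_one_of_forall_quartic {M t L : ℝ} (hM0 : 0 ≤ M) (ht0 : 0 < t) (hL : L ≤ t)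
    (hpoly : ∀ s : ℝ, M + 4 * s * L ≤ M * (1 + 2 * s * t + s ^ 2 * t) ^ 2) : M ≤ 1 := by
  by_contra! hM1
  have hquad : ∀ s : ℝ, 0 < s → s ≤ 1 → 4 * (M * t - t) ≤ s * (M * (2 * t + 8 * t ^ 2)) := by
    intro s hs hs1
    have h := hpoly (-s)
    have hLs : s * L ≤ s * t := mul_le_mul_of_nonneg_left hL hs.le
    have h' : s * (4 * (M * t - t)) ≤ s * (s * (M * (2 * t + 4 * t ^ 2)
        - 4 * (s * (M * t ^ 2)) + s ^ 2 * (M * t ^ 2))) := by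
      linear_combination h + 4 * hLs
    have h'' := le_of_mul_le_mul_left h' hs
    refine h''.trans ?_
    have hMt : 0 ≤ M * t ^ 2 := mul_nonneg hM0 (sq_nonneg t)
    have hs2 : s ^ 2 ≤ 1 := pow_le_one₀ hs.le hs1
    have h1 : 0 ≤ s * ((1 - s ^ 2) * (M * t ^ 2)) :=
      mul_nonneg hs.le (mul_nonneg (by linarith) hMt)
    have h2 : 0 ≤ s * (s * (M * t ^ 2)) := by positivity
    have h3 : 0 ≤ s * (M * t ^ 2) := by positivity
    linear_combination h1 + 4 * h2 + 3 * h3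
  have hd : 0 < 4 * (M * t - t) := by nlinarith
  have hC : 0 < M * (2 * t + 8 * t ^ 2) := by positivity
  set C := M * (2 * t + 8 * t ^ 2)
  have h1 := hquad (min 1 (4 * (M * t - t) / (2 * C))) (by positivity) (min_le_left _ _)
  have h2 := mul_le_mul_of_nonneg_right (min_le_right 1 (4 * (M * t - t) / (2 * C))) hC.le
  have h3 : 4 * (M * t - t) / (2 * C) * C = 4 * (M * t - t) / 2 := by field_simp
  linarith

section
variable {ι E F : Type*} [Fintype ι]
  [NormedAddCommGroup E] [InnerProductSpace ℝ E]
  [NormedAddCommGroup F] [InnerProductSpace ℝ F]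

/-- A combination of the `A b` with unit coefficient vector and maximal norm `√τ` bounds the
sums of squares of the inner products with the `A b`. -/
theorem exists_unit_combination (A : ι → E) [Nonempty ι] :
    ∃ u : ι → ℝ, ∑ b, u b ^ 2 = 1 ∧
      ∀ z : E, ∑ b, ⟪A b, z⟫ ^ 2 ≤ ‖∑ b, u b • A b‖ ^ 2 * ‖z‖ ^ 2 := by
  let S : Set (EuclideanSpace ℝ ι) := Metric.sphere 0 1
  have hne : S.Nonempty := by
    obtain ⟨i⟩ := ‹Nonempty ι›
    exact ⟨EuclideanSpace.single i 1, by simp [S]⟩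
  obtain ⟨u, huS, hu⟩ := (isCompact_sphere (0 : EuclideanSpace ℝ ι) 1).exists_isMaxOn hne
    (f := fun u => ‖∑ b, u b • A b‖ ^ 2) (by fun_prop)
  have hu1 : ‖u‖ = 1 := by simpa using huS
  have hmax : ∀ v : EuclideanSpace ℝ ι, ‖∑ b, v b • A b‖ ^ 2 ≤
      ‖∑ b, u b • A b‖ ^ 2 * ‖v‖ ^ 2 := by
    intro v
    rcases eq_or_ne v 0 with rfl | hv
    · simp
    have hv' : ‖v‖ ≠ 0 := norm_ne_zero_iff.mpr hv
    have := hu (show ‖v‖⁻¹ • v ∈ Metric.sphere (0 : EuclideanSpace ℝ ι) 1 by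
      simp [norm_smul, hv'])
    simp only [PiLp.smul_apply, smul_eq_mul, mul_smul, ← Finset.smul_sum, norm_smul, norm_inv,
      norm_norm, mul_pow, Set.mem_ofPred_eq, inv_pow] at this
    rwa [inv_mul_le_iff₀ (by positivity), mul_comm] at this
  refine ⟨u, ?_, fun z => ?_⟩
  · rw [← one_pow 2, ← hu1, EuclideanSpace.real_norm_sq_eq]
  · set s := ∑ b, ⟪A b, z⟫ ^ 2 with hs
    have hs0 : 0 ≤ s := Finset.sum_nonneg fun b _ => sq_nonneg _
    have hv := hmax (WithLp.toLp 2 fun b => ⟪A b, z⟫)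
    rw [EuclideanSpace.real_norm_sq_eq] at hv
    simp only [← hs] at hv
    have hin : ⟪∑ b, ⟪A b, z⟫ • A b, z⟫ = s := by
      rw [sum_inner, hs]
      exact Finset.sum_congr rfl fun b _ => by rw [real_inner_smul_left, sq]
    have hcs := abs_real_inner_le_norm (∑ b, ⟪A b, z⟫ • A b) z
    rw [hin, abs_of_nonneg hs0] at hcs
    have hsq := pow_le_pow_left₀ hs0 hcs 2
    rw [mul_pow] at hsq
    rcases hs0.eq_or_lt with h | h
    · rw [← h]
      positivity
    · have := hsq.trans (mul_le_mul_of_nonneg_right hv (sq_nonneg ‖z‖))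
      nlinarith

theorem sum_norm_bracket_combination_le (B : E →ₗ[ℝ] E →ₗ[ℝ] F) (hB : ∀ x, B x x = 0)
    (hkey : ∀ (x : E) (y : ι → E),
      (∀ z, ∑ b, ⟪y b, z⟫ ^ 2 ≤ ‖x‖ ^ 2 * ‖z‖ ^ 2) →
      ∑ b, ‖B x (y b)‖ ^ 2 ≤ ‖x‖ ^ 2 * (∑ b, ‖y b‖ ^ 2 + ‖x‖ ^ 2))
    (A : ι → E) (u : ι → ℝ) (hu : ∑ b, u b ^ 2 = 1)
    (hmax : ∀ z : E, ∑ b, ⟪A b, z⟫ ^ 2 ≤ ‖∑ b, u b • A b‖ ^ 2 * ‖z‖ ^ 2) :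
    ∑ b, ‖B (∑ a, u a • A a) (A b)‖ ^ 2 ≤ ‖∑ a, u a • A a‖ ^ 2 * ∑ b, ‖A b‖ ^ 2 := by
  set x := ∑ a, u a • A a with hx
  have hux : ∀ z, ∑ b, u b * ⟪A b, z⟫ = ⟪x, z⟫ := fun z => by
    rw [hx, sum_inner]
    exact Finset.sum_congr rfl fun b _ => (real_inner_smul_left _ _ _).symm
  have hsq : ∀ z, ∑ b, ⟪A b - u b • x, z⟫ ^ 2 = ∑ b, ⟪A b, z⟫ ^ 2 - ⟪x, z⟫ ^ 2 := by
    intro z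
    have : ∀ b, ⟪A b - u b • x, z⟫ ^ 2 =
        ⟪A b, z⟫ ^ 2 - 2 * ⟪x, z⟫ * (u b * ⟪A b, z⟫) + ⟪x, z⟫ ^ 2 * u b ^ 2 := fun b => by
      rw [inner_sub_left, real_inner_smul_left]
      ring
    simp only [this, Finset.sum_add_distrib, Finset.sum_sub_distrib, ← Finset.mul_sum, hux, hu]
    ring
  have hnorm : ∑ b, ‖A b - u b • x‖ ^ 2 = ∑ b, ‖A b‖ ^ 2 - ‖x‖ ^ 2 := by
    have : ∀ b, ‖A b - u b • x‖ ^ 2 =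
        ‖A b‖ ^ 2 - 2 * (u b * ⟪A b, x⟫) + ‖x‖ ^ 2 * u b ^ 2 := fun b => by
      rw [norm_sub_sq_real, real_inner_smul_right, norm_smul, mul_pow, Real.norm_eq_abs, sq_abs]
      ring
    simp only [this, Finset.sum_add_distrib, Finset.sum_sub_distrib, ← Finset.mul_sum, hux, hu,
      real_inner_self_eq_norm_sq]
    ring
  have := hkey x (fun b => A b - u b • x) fun z => by
    rw [hsq]
    linarith [hmax z, sq_nonneg ⟪x, z⟫]
  simpa only [map_sub, map_smul, hB, smul_zero, sub_zero, hnorm, sub_add_cancel] using this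

theorem sum_norm_bracket_le [FiniteDimensional ℝ E] (B : E →ₗ[ℝ] E →ₗ[ℝ] F) (hB : ∀ x, B x x = 0)
    (hkey : ∀ (x : E) (y : ι → E),
      (∀ z, ∑ b, ⟪y b, z⟫ ^ 2 ≤ ‖x‖ ^ 2 * ‖z‖ ^ 2) →
      ∑ b, ‖B x (y b)‖ ^ 2 ≤ ‖x‖ ^ 2 * (∑ b, ‖y b‖ ^ 2 + ‖x‖ ^ 2))
    (A : ι → E) :
    ∑ a, ∑ b, ‖B (A a) (A b)‖ ^ 2 ≤ (∑ a, ‖A a‖ ^ 2) ^ 2 := by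
  have hanti : ∀ x y, B y x = - B x y := fun x y => by
    have := hB (x + y)
    simp only [map_add, LinearMap.add_apply, hB, zero_add, add_zero] at this
    rwa [eq_neg_iff_add_eq_zero]
  have hcont : Continuous fun A : ι → E => ∑ a, ∑ b, ‖B (A a) (A b)‖ ^ 2 := by
    have : ∀ a b, Continuous fun A : ι → E => B (A a) (A b) := fun a b => by
      have h := ((B.toContinuousBilinearMap).isBoundedBilinearMap.continuous).comp
        ((continuous_apply a).prodMk (continuous_apply b) : Continuous fun A : ι → E => (A a, A b))
      exact h
    exact continuous_finsetSum _ fun a _ => continuous_finsetSum _ fun b _ =>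
      (this a b).norm.pow 2
  have hzero : ∀ A : ι → E, ∑ a, ‖A a‖ ^ 2 = 0 → A = 0 := by
    intro A hA
    rw [Finset.sum_eq_zero_iff_of_nonneg fun a _ => sq_nonneg _] at hA
    funext a
    simpa using hA a (Finset.mem_univ a)
  set T : Set (ι → E) := {A | ∑ a, ‖A a‖ ^ 2 = 1} with hT
  have hTc : IsCompact T := by
    refine Metric.isCompact_of_isClosed_isBounded
      (isClosed_eq (by fun_prop) continuous_const) ?_
    refine (Metric.isBounded_closedBall (x := (0 : ι → E)) (r := 1)).subset fun A hA => ?_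
    rw [mem_closedBall_zero_iff, pi_norm_le_iff_of_nonneg zero_le_one]
    intro a
    have h1 : ‖A a‖ ^ 2 ≤ 1 := by
      rw [← show ∑ a, ‖A a‖ ^ 2 = 1 from hA]
      exact Finset.single_le_sum (f := fun a => ‖A a‖ ^ 2) (fun a _ => sq_nonneg _)
        (Finset.mem_univ a)
    exact (sq_le_one_iff₀ (norm_nonneg _)).mp h1
  have hscale : ∀ A : ι → E, A ≠ 0 →
      ∃ r : ℝ, r ^ 2 * ∑ a, ‖A a‖ ^ 2 = 1 ∧ r • A ∈ T := by
    intro A hA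
    have hpos : 0 < ∑ a, ‖A a‖ ^ 2 :=
      lt_of_le_of_ne (Finset.sum_nonneg fun a _ => sq_nonneg _) fun h => hA (hzero A h.symm)
    have h1 : (√(∑ a, ‖A a‖ ^ 2))⁻¹ ^ 2 * ∑ a, ‖A a‖ ^ 2 = 1 := by
      rw [inv_pow, Real.sq_sqrt hpos.le, inv_mul_cancel₀ hpos.ne']
    refine ⟨_, h1, ?_⟩
    simp only [hT, Set.mem_ofPred_eq, Pi.smul_apply, norm_smul, mul_pow, ← Finset.mul_sum,
      Real.norm_eq_abs, sq_abs]
    exact h1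
  rcases eq_or_ne A 0 with rfl | hA
  · simp
  have : Nonempty ι := by
    by_contra h
    rw [not_nonempty_iff] at h
    exact hA (Subsingleton.elim _ _)
  obtain ⟨r, -, hrT⟩ := hscale A hA
  obtain ⟨A₀, hA₀, hmax⟩ := hTc.exists_isMaxOn ⟨_, hrT⟩ hcont.continuousOn
  set M := ∑ a, ∑ b, ‖B (A₀ a) (A₀ b)‖ ^ 2 with hM
  have hM0 : 0 ≤ M := Finset.sum_nonneg fun a _ => Finset.sum_nonneg fun b _ => sq_nonneg _
  have hA₀1 : ∑ a, ‖A₀ a‖ ^ 2 = 1 := hA₀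
  have hle : ∀ A : ι → E, ∑ a, ∑ b, ‖B (A a) (A b)‖ ^ 2 ≤ M * (∑ a, ‖A a‖ ^ 2) ^ 2 := by
    intro A
    rcases eq_or_ne A 0 with rfl | hA
    · simp
    obtain ⟨r, hr1, hrT⟩ := hscale A hA
    have h := hmax hrT
    simp only [Pi.smul_apply, map_smul, LinearMap.smul_apply, norm_smul, mul_pow,
      ← Finset.mul_sum, Real.norm_eq_abs, sq_abs, Set.mem_ofPred_eq, ← hM] at h
    set N := ∑ a, ‖A a‖ ^ 2
    set K := ∑ a, ∑ b, ‖B (A a) (A b)‖ ^ 2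
    calc K = r ^ 2 * (r ^ 2 * K) * N ^ 2 := by linear_combination (-K * (r ^ 2 * N + 1)) * hr1
      _ ≤ M * N ^ 2 := mul_le_mul_of_nonneg_right h (sq_nonneg N)
  suffices hM1 : M ≤ 1 from (hle A).trans (mul_le_of_le_one_left (sq_nonneg _) hM1)
  obtain ⟨u, hu1, hu⟩ := exists_unit_combination A₀
  have hL := sum_norm_bracket_combination_le B hB hkey A₀ u hu1 hu
  have ht0 : 0 < ‖∑ a, u a • A₀ a‖ ^ 2 := by
    refine lt_of_le_of_ne (sq_nonneg _) fun h => ?_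
    have hz : ∀ a, A₀ a = 0 := by
      intro a
      have h1 := hu (A₀ a)
      rw [← h, zero_mul] at h1
      have h2 := (Finset.single_le_sum (f := fun b => ⟪A₀ b, A₀ a⟫ ^ 2)
        (fun b _ => sq_nonneg _) (Finset.mem_univ a)).trans h1
      simpa using le_antisymm h2 (sq_nonneg _)
    simp [hz] at hA₀1
  have hux : ∀ z, ∑ b, u b * ⟪A₀ b, z⟫ = ⟪∑ a, u a • A₀ a, z⟫ := fun z => by
    rw [sum_inner]
    exact Finset.sum_congr rfl fun b _ => (real_inner_smul_left _ _ _).symm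
  have hBu : ∀ y, ∑ a, u a • B (A₀ a) y = B (∑ a, u a • A₀ a) y := fun y => by
    simp [map_sum, LinearMap.sum_apply]
  set x := ∑ a, u a • A₀ a
  set t := ‖x‖ ^ 2 with ht
  set L := ∑ b, ‖B x (A₀ b)‖ ^ 2 with hLdef
  have hN : ∀ s : ℝ, ∑ a, ‖A₀ a + (s * u a) • x‖ ^ 2 = 1 + 2 * s * t + s ^ 2 * t := by
    intro s
    have : ∀ a, ‖A₀ a + (s * u a) • x‖ ^ 2 =
        ‖A₀ a‖ ^ 2 + 2 * s * (u a * ⟪A₀ a, x⟫) + s ^ 2 * t * u a ^ 2 := fun a => by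
      rw [norm_add_sq_real, real_inner_smul_right, norm_smul, mul_pow, Real.norm_eq_abs, sq_abs]
      ring
    simp only [this, Finset.sum_add_distrib, ← Finset.mul_sum, hux, hu1,
      real_inner_self_eq_norm_sq, hA₀1, ← ht]
    ring
  have hK : ∀ s : ℝ, M + 4 * s * L ≤
      ∑ a, ∑ b, ‖B (A₀ a + (s * u a) • x) (A₀ b + (s * u b) • x)‖ ^ 2 := by
    intro s
    have hterm : ∀ a b, ‖B (A₀ a) (A₀ b)‖ ^ 2 + 2 * s * (⟪u a • B (A₀ a) (A₀ b), B x (A₀ b)⟫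
        + ⟪u b • B (A₀ b) (A₀ a), B x (A₀ a)⟫) ≤
        ‖B (A₀ a + (s * u a) • x) (A₀ b + (s * u b) • x)‖ ^ 2 := by
      intro a b
      have hexp : B (A₀ a + (s * u a) • x) (A₀ b + (s * u b) • x) =
          B (A₀ a) (A₀ b) + s • (u a • B x (A₀ b) - u b • B x (A₀ a)) := by
        simp only [map_add, LinearMap.add_apply, map_smul, LinearMap.smul_apply, hB,
          hanti x (A₀ a), smul_zero, add_zero]
        module
      rw [hexp, norm_add_sq_real, real_inner_smul_right, inner_sub_right, real_inner_smul_right,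
        real_inner_smul_right, real_inner_smul_left, real_inner_smul_left,
        hanti (A₀ a) (A₀ b), inner_neg_left]
      nlinarith [sq_nonneg ‖s • (u a • B x (A₀ b) - u b • B x (A₀ a))‖]
    refine le_trans (le_of_eq ?_)
      (Finset.sum_le_sum fun a _ => Finset.sum_le_sum fun b _ => hterm a b)
    have h1 : ∑ a, ∑ b, ⟪u a • B (A₀ a) (A₀ b), B x (A₀ b)⟫ = L := by
      rw [Finset.sum_comm]
      refine Finset.sum_congr rfl fun b _ => ?_
      rw [← sum_inner, hBu, real_inner_self_eq_norm_sq]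
    have h2 : ∑ a, ∑ b, ⟪u b • B (A₀ b) (A₀ a), B x (A₀ a)⟫ = L := by
      rw [Finset.sum_comm, h1]
    simp only [Finset.sum_add_distrib, ← Finset.mul_sum, h1, h2, ← hM]
    ring
  have hpoly : ∀ s : ℝ, M + 4 * s * L ≤ M * (1 + 2 * s * t + s ^ 2 * t) ^ 2 := by
    intro s
    have h := (hK s).trans (hle fun a => A₀ a + (s * u a) • x)
    rwa [hN] at h
  rw [hA₀1, mul_one] at hL
  exact le_one_of_forall_quartic hM0 ht0 hL hpoly
end

section
variable {ι κ : Type*} [Fintype ι] [Fintype κ]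

/-- The symmetric matrices, as a subspace of the Euclidean space of matrices. -/
def symMatrix (ι : Type*) [Fintype ι] : Submodule ℝ (EuclideanSpace ℝ (ι × ι)) where
  carrier := {x | ∀ i j, x (i, j) = x (j, i)}
  add_mem' hx hy i j := by simp [hx i j, hy i j]
  zero_mem' i j := by simp
  smul_mem' c x hx i j := by simp [hx i j]

/-- The matrix of an element of `symMatrix ι`. -/
def symMatrix.toMatrix (x : symMatrix ι) : Matrix ι ι ℝ := fun i j => x.1 (i, j)

open Matrix in
theorem symMatrix.transpose_toMatrix (x : symMatrix ι) :
    (symMatrix.toMatrix x)ᵀ = symMatrix.toMatrix x :=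
  Matrix.ext fun i j => x.2 j i

theorem symMatrix.inner_eq (x y : symMatrix ι) :
    ⟪x, y⟫ = ∑ i, ∑ j, symMatrix.toMatrix x i j * symMatrix.toMatrix y i j := by
  rw [Submodule.coe_inner, PiLp.inner_apply, Fintype.sum_prod_type]
  simp [symMatrix.toMatrix, mul_comm]

theorem symMatrix.norm_sq_eq (x : symMatrix ι) :
    ‖x‖ ^ 2 = ∑ i, ∑ j, symMatrix.toMatrix x i j ^ 2 := by
  rw [← real_inner_self_eq_norm_sq, symMatrix.inner_eq]
  simp only [sq]

/-- The commutator of symmetric matrices. -/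
noncomputable def symMatrix.bracket :
    symMatrix ι →ₗ[ℝ] symMatrix ι →ₗ[ℝ] EuclideanSpace ℝ (ι × ι) :=
  LinearMap.mk₂ ℝ
    (fun x y => WithLp.toLp 2 fun p =>
      (symMatrix.toMatrix x * symMatrix.toMatrix y
        - symMatrix.toMatrix y * symMatrix.toMatrix x) p.1 p.2)
    (fun x x' y => by
      have : symMatrix.toMatrix (x + x') = symMatrix.toMatrix x + symMatrix.toMatrix x' := rfl
      ext p
      simp [this, Matrix.add_mul, Matrix.mul_add]
      ring)
    (fun c x y => by
      have : symMatrix.toMatrix (c • x) = c • symMatrix.toMatrix x := rfl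
      ext p
      simp [this, mul_sub])
    (fun x y y' => by
      have : symMatrix.toMatrix (y + y') = symMatrix.toMatrix y + symMatrix.toMatrix y' := rfl
      ext p
      simp [this, Matrix.add_mul, Matrix.mul_add]
      ring)
    (fun c x y => by
      have : symMatrix.toMatrix (c • y) = c • symMatrix.toMatrix y := rfl
      ext p
      simp [this, mul_sub])

theorem symMatrix.norm_bracket_sq (x y : symMatrix ι) : ‖symMatrix.bracket x y‖ ^ 2 =
    ∑ i, ∑ j, (symMatrix.toMatrix x * symMatrix.toMatrix y
      - symMatrix.toMatrix y * symMatrix.toMatrix x) i j ^ 2 := by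
  rw [EuclideanSpace.real_norm_sq_eq, Fintype.sum_prod_type]
  rfl

open Matrix in
/-- The DDVV inequality for symmetric matrices. -/
theorem sum_commutator_sq_le (A : κ → Matrix ι ι ℝ) (hA : ∀ a, (A a)ᵀ = A a) :
    ∑ a, ∑ b, ∑ i, ∑ j, (A a * A b - A b * A a) i j ^ 2 ≤ (∑ a, ∑ i, ∑ j, A a i j ^ 2) ^ 2 := by
  let x : κ → symMatrix ι := fun a =>
    ⟨WithLp.toLp 2 fun p => A a p.1 p.2, fun i j => (congrFun (congrFun (hA a) i) j).symm⟩
  have hx : ∀ a, symMatrix.toMatrix (x a) = A a := fun a => rfl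
  have h := sum_norm_bracket_le (symMatrix.bracket (ι := ι)) (fun x => by
      ext p
      simp [symMatrix.bracket]) (fun x y h => ?_) x
  · simpa only [symMatrix.norm_bracket_sq, symMatrix.norm_sq_eq, hx] using h
  · have hc := sum_commutator_le (symMatrix.toMatrix x) (symMatrix.transpose_toMatrix x)
      (fun b => symMatrix.toMatrix (y b)) (fun b => symMatrix.transpose_toMatrix (y b))
      (‖x‖ ^ 2) (sq_nonneg _) (fun Z hZ => by
        have hz := h ⟨WithLp.toLp 2 fun p => Z p.1 p.2,
          fun i j => (congrFun (congrFun hZ i) j).symm⟩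
        simp only [symMatrix.inner_eq, symMatrix.norm_sq_eq] at hz ⊢
        exact hz)
    simpa only [symMatrix.norm_bracket_sq, symMatrix.norm_sq_eq] using hc
end

theorem inner_shapeOp (e : OrthonormalBasis (Fin n) ℝ V) (β : V →ₗ[ℝ] V →ₗ[ℝ] W) (η : W)
    (x y : V) : ⟪shapeOp β η x, y⟫ = ⟪β x y, η⟫ := by
  have h : ∃ A : V →ₗ[ℝ] V, ∀ x y : V, ⟪β x y, η⟫ = ⟪A x, y⟫ := by
    refine ⟨∑ i, ((innerₗ W η).comp (β.flip (e i))).smulRight (e i), fun x y => ?_⟩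
    conv_lhs => rw [← e.sum_repr' y]
    simp only [map_sum, map_smul, sum_inner, LinearMap.sum_apply, LinearMap.smulRight_apply,
      LinearMap.comp_apply, LinearMap.flip_apply, innerₗ_apply_apply, real_inner_smul_left]
    exact Finset.sum_congr rfl fun i _ => by rw [mul_comm, real_inner_comm η]
  rw [shapeOp, dif_pos h]
  exact (h.choose_spec x y).symm

/-- The matrix of the shape operator of the traceless part of `β` in direction `η`. -/
noncomputable def tracelessMatrix (e : OrthonormalBasis (Fin n) ℝ V) (β : V →ₗ[ℝ] V →ₗ[ℝ] W)
    (η : W) : Matrix (Fin n) (Fin n) ℝ :=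
  fun i j => ⟪β (e i) (e j) - ⟪e i, e j⟫ • meanCurv e β, η⟫

theorem sum_norm_sq_shapeOp_commutator (e : OrthonormalBasis (Fin n) ℝ V)
    (β : V →ₗ[ℝ] V →ₗ[ℝ] W) (hβ : IsSymmBil β) (η ζ : W) :
    ∑ i, ‖(shapeOp β η ∘ₗ shapeOp β ζ - shapeOp β ζ ∘ₗ shapeOp β η) (e i)‖ ^ 2 =
      ∑ i, ∑ j, (tracelessMatrix e β η * tracelessMatrix e β ζ
        - tracelessMatrix e β ζ * tracelessMatrix e β η) i j ^ 2 := by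
  let X : W → Matrix (Fin n) (Fin n) ℝ := fun η i j => ⟪β (e i) (e j), η⟫
  have hX : ∀ η, tracelessMatrix e β η = X η - ⟪meanCurv e β, η⟫ • (1 : Matrix _ _ ℝ) := by
    intro η
    ext i j
    rw [Matrix.sub_apply, Matrix.smul_apply, Matrix.one_apply, tracelessMatrix, inner_sub_left,
      real_inner_smul_left, e.inner_eq_ite, smul_eq_mul, mul_comm]
  have hcomm : tracelessMatrix e β η * tracelessMatrix e β ζ
        - tracelessMatrix e β ζ * tracelessMatrix e β η = X η * X ζ - X ζ * X η := by
    rw [hX, hX]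
    simp only [Matrix.sub_mul, Matrix.mul_sub, Matrix.smul_mul, Matrix.mul_smul, Matrix.one_mul,
      Matrix.mul_one, smul_sub]
    rw [smul_comm]
    abel
  have hprod : ∀ η ζ i j, ⟪shapeOp β η (shapeOp β ζ (e i)), e j⟫ = (X ζ * X η) i j := by
    intro η ζ i j
    rw [inner_shapeOp e, hβ, ← inner_shapeOp e, real_inner_comm, ← e.sum_inner_mul_inner,
      Matrix.mul_apply]
    refine Finset.sum_congr rfl fun k _ => ?_
    rw [inner_shapeOp e, real_inner_comm (shapeOp β η (e j)) (e k), inner_shapeOp e, hβ (e j) (e k)]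
  rw [hcomm]
  refine Finset.sum_congr rfl fun i _ => ?_
  rw [← e.sum_sq_inner_right]
  refine Finset.sum_congr rfl fun j _ => ?_
  rw [real_inner_comm, LinearMap.sub_apply, inner_sub_left, LinearMap.comp_apply,
    LinearMap.comp_apply, hprod, hprod, Matrix.sub_apply]
  ring

/-- The squared Hilbert–Schmidt norm of the traceless part of `β`. -/
noncomputable def tracelessNormSq (e : OrthonormalBasis (Fin n) ℝ V)
    (β : V →ₗ[ℝ] V →ₗ[ℝ] W) : ℝ :=
  ∑ i, ∑ j, ‖β (e i) (e j) - ⟪e i, e j⟫ • meanCurv e β‖ ^ 2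

theorem tracelessNormSq_nonneg (e : OrthonormalBasis (Fin n) ℝ V) (β : V →ₗ[ℝ] V →ₗ[ℝ] W) :
    0 ≤ tracelessNormSq e β :=
  Finset.sum_nonneg fun _ _ => Finset.sum_nonneg fun _ _ => sq_nonneg _

theorem sum_tracelessMatrix_sq (e : OrthonormalBasis (Fin n) ℝ V)
    (ξ : OrthonormalBasis (Fin m) ℝ W) (β : V →ₗ[ℝ] V →ₗ[ℝ] W) :
    ∑ a, ∑ i, ∑ j, tracelessMatrix e β (ξ a) i j ^ 2 = tracelessNormSq e β := by
  rw [Finset.sum_comm, tracelessNormSq]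
  refine Finset.sum_congr rfl fun i _ => ?_
  rw [Finset.sum_comm]
  refine Finset.sum_congr rfl fun j _ => ?_
  rw [← ξ.sum_sq_inner_left]
  rfl

theorem rhoPerp_le (hn : 2 ≤ n) (e : OrthonormalBasis (Fin n) ℝ V)
    (ξ : OrthonormalBasis (Fin m) ℝ W) (β : V →ₗ[ℝ] V →ₗ[ℝ] W) (hβ : IsSymmBil β) :
    rhoPerp e ξ β ≤ (n * (n - 1) : ℝ)⁻¹ * tracelessNormSq e β := by
  have hn' : (2 : ℝ) ≤ n := by exact_mod_cast hn
  refine mul_le_mul_of_nonneg_left ?_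
    (inv_nonneg.mpr (mul_nonneg (by linarith) (by linarith)))
  refine Real.sqrt_le_iff.mpr ⟨tracelessNormSq_nonneg e β, ?_⟩
  simp only [sum_norm_sq_shapeOp_commutator e β hβ]
  rw [← sum_tracelessMatrix_sq e ξ β]
  refine sum_commutator_sq_le _ fun a => ?_
  ext i j
  simp only [Matrix.transpose_apply, tracelessMatrix, hβ (e j) (e i), real_inner_comm (e i)]

theorem rho_eq (hn : 2 ≤ n) (e : OrthonormalBasis (Fin n) ℝ V) (β : V →ₗ[ℝ] V →ₗ[ℝ] W) (c : ℝ) :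
    rho c e β = c + ‖meanCurv e β‖ ^ 2 - (n * (n - 1) : ℝ)⁻¹ * tracelessNormSq e β := by
  have hn' : (2 : ℝ) ≤ n := by exact_mod_cast hn
  have hn0 : (n : ℝ) ≠ 0 := by linarith
  have hn1 : (n : ℝ) - 1 ≠ 0 := by linarith
  have hH : ∑ i, β (e i) (e i) = (n : ℝ) • meanCurv e β := by
    rw [meanCurv, smul_inv_smul₀ hn0]
  set H := meanCurv e β with hHdef
  have hT : tracelessNormSq e β = ∑ i, ∑ j, ‖β (e i) (e j)‖ ^ 2 - n * ‖H‖ ^ 2 := by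
    have h1 : ∀ i j, ‖β (e i) (e j) - ⟪e i, e j⟫ • H‖ ^ 2 = ‖β (e i) (e j)‖ ^ 2
        + if i = j then ‖H‖ ^ 2 - 2 * ⟪β (e i) (e i), H⟫ else 0 := by
      intro i j
      rw [e.inner_eq_ite]
      split_ifs with h
      · subst h
        rw [one_smul, norm_sub_sq_real]
        ring
      · simp
    simp only [tracelessNormSq, ← hHdef, h1, Finset.sum_add_distrib, Finset.sum_ite_eq,
      Finset.mem_univ, if_true, Finset.sum_sub_distrib, ← Finset.mul_sum, ← sum_inner, hH,
      real_inner_smul_left, real_inner_self_eq_norm_sq, Finset.sum_const, Finset.card_univ,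
      Fintype.card_fin, nsmul_eq_mul]
    ring
  have hR : ∑ i, ric c e β (e i) (e i) =
      n * (c * (n - 1)) + n * (n * ‖H‖ ^ 2) - ∑ i, ∑ j, ‖β (e i) (e j)‖ ^ 2 := by
    simp only [ric, ← hHdef, Finset.sum_sub_distrib, Finset.sum_add_distrib, ← Finset.mul_sum,
      ← inner_sum, hH, real_inner_smul_right, real_inner_self_eq_norm_sq,
      e.norm_eq_one, one_pow, mul_one, Finset.sum_const, Finset.card_univ,
      Fintype.card_fin, nsmul_eq_mul]
    ring
  rw [rho, hR, hT]
  field_simp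
  ring

theorem tracelessNormSq_eq_zero_iff (e : OrthonormalBasis (Fin n) ℝ V)
    (β : V →ₗ[ℝ] V →ₗ[ℝ] W) :
    tracelessNormSq e β = 0 ↔ ∀ x y : V, β x y = ⟪x, y⟫ • meanCurv e β := by
  constructor
  · intro h
    have hz : ∀ i j, β (e i) (e j) = ⟪e i, e j⟫ • meanCurv e β := by
      intro i j
      rw [tracelessNormSq, Finset.sum_eq_zero_iff_of_nonneg fun i _ =>
        Finset.sum_nonneg fun j _ => sq_nonneg _] at h
      have h1 := h i (Finset.mem_univ i)
      rw [Finset.sum_eq_zero_iff_of_nonneg fun j _ => sq_nonneg _] at h1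
      have h2 := h1 j (Finset.mem_univ j)
      rwa [sq_eq_zero_iff, norm_eq_zero, sub_eq_zero] at h2
    have hext : β = (innerₗ V).compr₂ (LinearMap.toSpanSingleton ℝ W (meanCurv e β)) := by
      refine e.toBasis.ext fun i => e.toBasis.ext fun j => ?_
      simpa using hz i j
    intro x y
    conv_lhs => rw [hext]
    simp
  · intro h
    simp [tracelessNormSq, h]

/-- `ρ_c(β) ≤ c + H_β² − λ·ρ⊥(β)` for every `λ ∈ [0,1)`, with equality for
some such `λ` iff `β` is umbilical. -/
theorem stmt6 (n m : ℕ) (hn : 2 ≤ n) (hm : 1 ≤ m)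
    {V W : Type*} [NormedAddCommGroup V] [InnerProductSpace ℝ V]
    [NormedAddCommGroup W] [InnerProductSpace ℝ W]
    (e : OrthonormalBasis (Fin n) ℝ V) (ξ : OrthonormalBasis (Fin m) ℝ W)
    (β : V →ₗ[ℝ] V →ₗ[ℝ] W) (hβ : IsSymmBil β) (c : ℝ) :
    (∀ lam : ℝ, 0 ≤ lam → lam < 1 →
      rho c e β ≤ c + ‖meanCurv e β‖ ^ 2 - lam * rhoPerp e ξ β) ∧
    ((∃ lam : ℝ, 0 ≤ lam ∧ lam < 1 ∧
        rho c e β = c + ‖meanCurv e β‖ ^ 2 - lam * rhoPerp e ξ β) ↔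
      ∀ x y : V, β x y = ⟪x, y⟫ • meanCurv e β) := by
  have hn' : (2 : ℝ) ≤ n := by exact_mod_cast hn
  have hk : (0 : ℝ) < (n * (n - 1) : ℝ)⁻¹ :=
    inv_pos.mpr (mul_pos (by linarith) (by linarith))
  have hT := tracelessNormSq_nonneg e β
  have hP := rhoPerp_le hn e ξ β hβ
  have hrho := rho_eq hn e β c
  have hkT := mul_nonneg hk.le hT
  refine ⟨fun lam h0 h1 => ?_, ?_⟩
  · nlinarith [mul_le_mul_of_nonneg_left hP h0]
  · rw [← tracelessNormSq_eq_zero_iff]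
    constructor
    · rintro ⟨lam, h0, h1, heq⟩
      have h2 : (n * (n - 1) : ℝ)⁻¹ * tracelessNormSq e β ≤ 0 := by
        nlinarith [mul_le_mul_of_nonneg_left hP h0]
      exact (mul_eq_zero.mp (le_antisymm h2 hkT)).resolve_left hk.ne'
    · intro h
      exact ⟨0, le_rfl, one_pos, by rw [hrho, h]; ring⟩

end Paper
end

section
/- (Failure for k = n.) Let n ≥ 3, m ≥ 2 and c ∈ ℝ. Then for every δ > 0 there exists β ∈ Sym(V×V,W) such that ψ_0(β) > 0 and c + H_β² − ρ⊥(β) − ρ_c(β) < δ·(ψ_0(β))^{2/n}. In other words, there is no positive constant δ with c + H_β² − ρ⊥(β) − ρ_c(β) ≥ δ·(ψ_0(β))^{2/n} for all β. -/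
open scoped RealInnerProductSpace BigOperators
open MeasureTheory Classical

namespace Paper

variable {V W : Type*} [NormedAddCommGroup V] [InnerProductSpace ℝ V]
  [NormedAddCommGroup W] [InnerProductSpace ℝ W]

variable {n m : ℕ}

section ShapeOperators

theorem shapeOp_eq {β : V →ₗ[ℝ] V →ₗ[ℝ] W} {ξ : W} {A : V →ₗ[ℝ] V}
    (hA : ∀ x y : V, ⟪β x y, ξ⟫ = ⟪A x, y⟫) : shapeOp β ξ = A := by
  have h : ∃ A : V →ₗ[ℝ] V, ∀ x y : V, ⟪β x y, ξ⟫ = ⟪A x, y⟫ := ⟨A, hA⟩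
  rw [shapeOp, dif_pos h]
  ext x
  exact ext_inner_right ℝ fun y => by rw [← h.choose_spec x y, hA x y]

theorem sortedEigs_spec [FiniteDimensional ℝ V] {n : ℕ} (hn : Module.finrank ℝ V = n)
    {T : V →ₗ[ℝ] V} (hT : T.IsSymmetric) :
    ∃ b : OrthonormalBasis (Fin n) ℝ V, ∀ i, T (b i) = sortedEigs n T i • b i := by
  have h : ∃ μ : Fin n → ℝ, Monotone μ ∧
      ∃ b : OrthonormalBasis (Fin n) ℝ V, ∀ i, T (b i) = μ i • b i :=
    ⟨fun i => hT.eigenvalues hn i.rev,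
      (hT.eigenvalues_antitone hn).comp Fin.rev_anti,
      (hT.eigenvectorBasis hn).reindex Fin.revPerm, fun i => by
        simp⟩
  rw [sortedEigs, dif_pos h]
  exact h.choose_spec.2

theorem inner_apply_self_eq_sum_eigs {ι : Type*} [Fintype ι] (b : OrthonormalBasis ι ℝ V)
    {T : V →ₗ[ℝ] V} {μ : ι → ℝ} (hb : ∀ i, T (b i) = μ i • b i) (x : V) :
    ⟪T x, x⟫ = ∑ i, μ i * ⟪b i, x⟫ ^ 2 := by
  conv_lhs => rw [← b.sum_repr x]
  simp only [map_sum, map_smul, hb, sum_inner, inner_smul_left, b.repr_apply_apply]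
  rw [b.sum_repr' x]
  refine Finset.sum_congr rfl fun i _ => ?_
  simp
  ring

theorem negIndex_pos [FiniteDimensional ℝ V] {n : ℕ} (hn : Module.finrank ℝ V = n)
    {T : V →ₗ[ℝ] V} (hT : T.IsSymmetric) {x : V} (hx : ⟪T x, x⟫ < 0) : 0 < negIndex n T := by
  obtain ⟨b, hb⟩ := sortedEigs_spec hn hT
  rw [negIndex, Finset.card_pos]
  by_contra h
  rw [Finset.not_nonempty_iff_eq_empty, Finset.filter_eq_empty_iff] at h
  rw [inner_apply_self_eq_sum_eigs b hb] at hx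
  exact hx.not_ge (Finset.sum_nonneg fun i hi => mul_nonneg (not_lt.1 (h hi)) (sq_nonneg _))

theorem negIndex_lt [FiniteDimensional ℝ V] {n : ℕ} (hn : Module.finrank ℝ V = n)
    {T : V →ₗ[ℝ] V} (hT : T.IsSymmetric) {x : V} (hx : 0 < ⟪T x, x⟫) : negIndex n T < n := by
  obtain ⟨b, hb⟩ := sortedEigs_spec hn hT
  rw [inner_apply_self_eq_sum_eigs b hb] at hx
  obtain ⟨i, -, hi⟩ : ∃ i ∈ Finset.univ, 0 < sortedEigs n T i * ⟪b i, x⟫ ^ 2 := by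
    by_contra! h
    exact hx.not_ge (Finset.sum_nonpos h)
  have hi' : 0 ≤ sortedEigs n T i := (pos_of_mul_pos_left hi (sq_nonneg _)).le
  simpa [negIndex] using Finset.card_lt_card
    (Finset.filter_ssubset.2 ⟨i, Finset.mem_univ i, hi'.not_gt⟩ :
      Finset.univ.filter (fun i : Fin n => sortedEigs n T i < 0) ⊂ Finset.univ)

end ShapeOperators

section Extremal

variable {k l : ℕ}

/-- The shape operator `id + diag(1, -1, 0, …, 0)`. -/
noncomputable def diagShape (k : ℕ) :
    EuclideanSpace ℝ (Fin (k + 2)) →ₗ[ℝ] EuclideanSpace ℝ (Fin (k + 2)) where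
  toFun x := x + x 0 • EuclideanSpace.single 0 1 - x 1 • EuclideanSpace.single 1 1
  map_add' x y := by simp only [PiLp.add_apply]; module
  map_smul' r x := by simp only [PiLp.smul_apply, smul_eq_mul, RingHom.id_apply]; module

/-- The shape operator exchanging the first two coordinates and killing the others. -/
noncomputable def swapShape (k : ℕ) :
    EuclideanSpace ℝ (Fin (k + 2)) →ₗ[ℝ] EuclideanSpace ℝ (Fin (k + 2)) where
  toFun x := x 1 • EuclideanSpace.single 0 1 + x 0 • EuclideanSpace.single 1 1
  map_add' x y := by simp only [PiLp.add_apply]; module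
  map_smul' r x := by simp only [PiLp.smul_apply, smul_eq_mul, RingHom.id_apply]; module

/-- A symmetric bilinear map, not umbilic and with nonzero mean curvature, for which the
inequality `ρ + ρ⊥ ≤ H² + c` is an equality. -/
noncomputable def extremal (k l : ℕ) :
    EuclideanSpace ℝ (Fin (k + 2)) →ₗ[ℝ] EuclideanSpace ℝ (Fin (k + 2)) →ₗ[ℝ]
      EuclideanSpace ℝ (Fin (l + 2)) :=
  LinearMap.mk₂ ℝ
    (fun x y => ⟪diagShape k x, y⟫ • EuclideanSpace.single 0 1
      + ⟪swapShape k x, y⟫ • EuclideanSpace.single 1 1)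
    (fun x x' y => by simp only [map_add, inner_add_left]; module)
    (fun r x y => by simp only [map_smul, real_inner_smul_left]; module)
    (fun x y y' => by simp only [inner_add_right]; module)
    (fun r x y => by simp only [real_inner_smul_right]; module)

theorem inner_diagShape (x y : EuclideanSpace ℝ (Fin (k + 2))) :
    ⟪diagShape k x, y⟫ = ⟪x, y⟫ + x 0 * y 0 - x 1 * y 1 := by
  simp [diagShape, inner_add_left, inner_sub_left, real_inner_smul_left,
    EuclideanSpace.inner_single_left]

theorem inner_swapShape (x y : EuclideanSpace ℝ (Fin (k + 2))) :
    ⟪swapShape k x, y⟫ = x 1 * y 0 + x 0 * y 1 := by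
  simp [swapShape, inner_add_left, real_inner_smul_left, EuclideanSpace.inner_single_left]

theorem extremal_apply (x y : EuclideanSpace ℝ (Fin (k + 2))) :
    extremal k l x y = (⟪x, y⟫ + x 0 * y 0 - x 1 * y 1) • EuclideanSpace.single 0 1
      + (x 1 * y 0 + x 0 * y 1) • EuclideanSpace.single 1 1 := by
  rw [← inner_diagShape, ← inner_swapShape]; rfl

theorem isSymmBil_extremal : IsSymmBil (extremal k l) := fun x y => by
  rw [extremal_apply, extremal_apply, real_inner_comm]
  module

theorem shapeOp_extremal (u : EuclideanSpace ℝ (Fin (l + 2))) :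
    shapeOp (extremal k l) u = u 0 • diagShape k + u 1 • swapShape k := by
  refine shapeOp_eq fun x y => ?_
  simp [extremal_apply, inner_add_left, real_inner_smul_left, inner_diagShape, inner_swapShape,
    EuclideanSpace.inner_single_left]
  ring

theorem isSymmetric_shapeOp_extremal (u : EuclideanSpace ℝ (Fin (l + 2))) :
    (shapeOp (extremal k l) u).IsSymmetric := fun x y => by
  rw [shapeOp_extremal, real_inner_comm _ x]
  simp [inner_add_left, real_inner_smul_left, inner_diagShape, inner_swapShape,
    real_inner_comm x y]
  ring

theorem continuous_det_shapeOp_extremal : Continuous fun u : EuclideanSpace ℝ (Fin (l + 2)) =>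
    LinearMap.det (shapeOp (extremal k l) u) := by
  let b := (EuclideanSpace.basisFun (Fin (k + 2)) ℝ).toBasis
  simp_rw [shapeOp_extremal, ← LinearMap.det_toMatrix b, map_add, map_smul]
  exact Continuous.matrix_det (by fun_prop)

theorem det_shapeOp_extremal_eq_zero {u : EuclideanSpace ℝ (Fin (l + 2))} (hu : u 1 = 0) :
    LinearMap.det (shapeOp (extremal k l) u) = 0 := by
  by_contra h
  have h1 : shapeOp (extremal k l) u (EuclideanSpace.single 1 1) = 0 := by
    rw [shapeOp_extremal, hu]
    simp [diagShape]
  have h2 := (LinearMap.equivOfDetNeZero _ h).injective (h1.trans (map_zero _).symm)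
  simpa using congrArg (fun x : EuclideanSpace ℝ (Fin (k + 2)) => x 1) h2

theorem det_shapeOp_extremal_ne_zero {u : EuclideanSpace ℝ (Fin (l + 2))} (h0 : u 0 ≠ 0)
    (h1 : u 1 ≠ 0) : LinearMap.det (shapeOp (extremal k l) u) ≠ 0 := by
  intro h
  obtain ⟨x, hx, hx0⟩ := Submodule.exists_mem_ne_zero_of_ne_bot
    (LinearMap.bot_lt_ker_of_det_eq_zero h).ne'
  refine hx0 ?_
  rw [LinearMap.mem_ker, shapeOp_extremal] at hx
  have hc : ∀ i, (u 0 * (x i + x 0 * (if i = 0 then 1 else 0) - x 1 * (if i = 1 then 1 else 0))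
      + u 1 * (x 1 * (if i = 0 then 1 else 0) + x 0 * (if i = 1 then 1 else 0))) = 0 := fun i => by
    simpa [diagShape, swapShape, Pi.single_apply, mul_add] using
      congrArg (fun y : EuclideanSpace ℝ (Fin (k + 2)) => y i) hx
  have hx0 : x 0 = 0 := by simpa [h1] using hc 1
  have hx1 : x 1 = 0 := by simpa [h1, hx0] using hc 0
  ext i
  simpa [hx0, hx1, h0] using hc i

theorem negIndex_shapeOp_extremal {u : EuclideanSpace ℝ (Fin (l + 2))} (hu : u 1 ≠ 0) :
    0 < negIndex (k + 2) (shapeOp (extremal k l) u) ∧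
      negIndex (k + 2) (shapeOp (extremal k l) u) < k + 2 := by
  have key : ∀ t : ℝ, ∃ x : EuclideanSpace ℝ (Fin (k + 2)),
      ⟪shapeOp (extremal k l) u x, x⟫ = 2 * u 1 ^ 2 * t := fun t => by
    refine ⟨EuclideanSpace.single 0 (u 1) + EuclideanSpace.single 1 (t - u 0), ?_⟩
    rw [shapeOp_extremal]
    simp only [LinearMap.add_apply, LinearMap.smul_apply, map_add, inner_add_left,
      inner_add_right, real_inner_smul_left]
    simp [inner_diagShape, inner_swapShape,
      EuclideanSpace.inner_single_left]
    ring
  have hsq : 0 < u 1 ^ 2 := by positivity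
  obtain ⟨x, hx⟩ := key (-1)
  obtain ⟨y, hy⟩ := key 1
  exact ⟨negIndex_pos finrank_euclideanSpace_fin (isSymmetric_shapeOp_extremal u) (x := x)
      (by linarith),
    negIndex_lt finrank_euclideanSpace_fin (isSymmetric_shapeOp_extremal u) (x := y)
      (by linarith)⟩

theorem meanCurv_extremal :
    meanCurv (EuclideanSpace.basisFun (Fin (k + 2)) ℝ) (extremal k l) =
      EuclideanSpace.single 0 1 := by
  simp [meanCurv, extremal_apply, Finset.sum_add_distrib, ← Finset.sum_smul]
  rw [smul_smul, inv_mul_cancel₀ (by positivity), one_smul]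

theorem rhoPerp_extremal :
    rhoPerp (EuclideanSpace.basisFun (Fin (k + 2)) ℝ) (EuclideanSpace.basisFun (Fin (l + 2)) ℝ)
      (extremal k l) = 4 * (((k + 2 : ℕ) : ℝ) * ((k + 2 : ℕ) - 1))⁻¹ := by
  have hcomm : ∀ (u v : EuclideanSpace ℝ (Fin (l + 2))) (x : EuclideanSpace ℝ (Fin (k + 2))),
      ‖(shapeOp (extremal k l) u ∘ₗ shapeOp (extremal k l) v
        - shapeOp (extremal k l) v ∘ₗ shapeOp (extremal k l) u) x‖ ^ 2
      = 4 * (u 0 * v 1 - u 1 * v 0) ^ 2 * (x 0 ^ 2 + x 1 ^ 2) := fun u v x => by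
    have : (shapeOp (extremal k l) u ∘ₗ shapeOp (extremal k l) v
        - shapeOp (extremal k l) v ∘ₗ shapeOp (extremal k l) u) x =
        (2 * (u 0 * v 1 - u 1 * v 0)) •
          (x 1 • EuclideanSpace.single 0 1 - x 0 • EuclideanSpace.single 1 1) := by
      simp [shapeOp_extremal, diagShape, swapShape]
      module
    rw [this, ← real_inner_self_eq_norm_sq]
    simp only [inner_sub_left, inner_sub_right, real_inner_smul_left, real_inner_smul_right]
    simp [EuclideanSpace.inner_single_left]
    ring
  have hsum : (∑ a : Fin (l + 2), ∑ b : Fin (l + 2), ∑ i : Fin (k + 2),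
      4 * ((EuclideanSpace.basisFun (Fin (l + 2)) ℝ a) 0 * (EuclideanSpace.basisFun (Fin (l + 2)) ℝ b) 1
        - (EuclideanSpace.basisFun (Fin (l + 2)) ℝ a) 1 * (EuclideanSpace.basisFun (Fin (l + 2)) ℝ b) 0) ^ 2
        * ((EuclideanSpace.basisFun (Fin (k + 2)) ℝ i) 0 ^ 2 +
          (EuclideanSpace.basisFun (Fin (k + 2)) ℝ i) 1 ^ 2)) = 4 ^ 2 := by
    simp [Fin.sum_univ_succ, (Fin.succ_ne_zero _).symm, (Fin.succ_succ_ne_one _).symm]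
    norm_num
  rw [rhoPerp]
  simp_rw [hcomm]
  rw [hsum, Real.sqrt_sq (by norm_num), mul_comm]

theorem norm_extremal_sq (x y : EuclideanSpace ℝ (Fin (k + 2))) :
    ‖extremal k l x y‖ ^ 2 = (⟪x, y⟫ + x 0 * y 0 - x 1 * y 1) ^ 2 + (x 1 * y 0 + x 0 * y 1) ^ 2 := by
  rw [← real_inner_self_eq_norm_sq, extremal_apply]
  simp only [inner_add_left, inner_add_right, real_inner_smul_left, real_inner_smul_right]
  simp [EuclideanSpace.inner_single_left]
  ring

theorem rho_extremal (c : ℝ) :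
    rho c (EuclideanSpace.basisFun (Fin (k + 2)) ℝ) (extremal k l) =
      c + 1 - 4 * (((k + 2 : ℕ) : ℝ) * ((k + 2 : ℕ) - 1))⁻¹ := by
  simp_rw [rho, ric, meanCurv_extremal, real_inner_self_eq_norm_sq, norm_extremal_sq]
  simp [Fin.sum_univ_succ, extremal_apply, (Fin.succ_ne_zero _).symm,
    (Fin.succ_succ_ne_one _).symm, EuclideanSpace.inner_single_left, Fin.succ_succ_ne_one,
    Finset.filter_eq]
  rw [show (k : ℝ) + 2 - 1 = k + 1 by ring]
  field_simp
  ring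

theorem psi_extremal_pos : 0 < psi (k + 2) (l + 2) 0 (extremal k l) := by
  rw [psi, setIntegral_eq_integral_of_forall_compl_eq_zero]
  · let v : EuclideanSpace ℝ (Fin (l + 2)) :=
      EuclideanSpace.single 0 (3 / 5) + EuclideanSpace.single 1 (4 / 5)
    have hv : v ∈ Metric.sphere (0 : EuclideanSpace ℝ (Fin (l + 2))) 1 := by
      rw [mem_sphere_zero_iff_norm, EuclideanSpace.norm_eq, Real.sqrt_eq_one]
      simp [v, Fin.sum_univ_succ, Fin.succ_succ_ne_one]
      norm_num
    refine Continuous.integral_pos_of_hasCompactSupport_nonneg_nonzero (x := ⟨v, hv⟩)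
      (continuous_det_shapeOp_extremal.comp continuous_subtype_val).abs
      (HasCompactSupport.of_compactSpace _) (fun u => abs_nonneg _) ?_
    exact abs_ne_zero.2 (det_shapeOp_extremal_ne_zero (by simp [v]) (by simp [v]))
  · intro u hu
    rw [abs_eq_zero]
    by_contra h
    exact hu (negIndex_shapeOp_extremal fun h1 => h (det_shapeOp_extremal_eq_zero h1))

end Extremal

/-- failure for `k = n`. -/
theorem stmt14 (n m : ℕ) (hn : 3 ≤ n) (hm : 2 ≤ m) (c : ℝ) :
    ∀ δ : ℝ, 0 < δ → ∃ β : EuclideanSpace ℝ (Fin n) →ₗ[ℝ] EuclideanSpace ℝ (Fin n) →ₗ[ℝ] EuclideanSpace ℝ (Fin m), IsSymmBil β ∧ 0 < psi n m 0 β ∧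
      c + ‖meanCurv (EuclideanSpace.basisFun (Fin n) ℝ) β‖ ^ 2
          - rhoPerp (EuclideanSpace.basisFun (Fin n) ℝ)
              (EuclideanSpace.basisFun (Fin m) ℝ) β
          - rho c (EuclideanSpace.basisFun (Fin n) ℝ) β
        < δ * psi n m 0 β ^ ((2 : ℝ) / (n : ℝ)) := by
  intro δ hδ
  obtain ⟨k, rfl⟩ := Nat.exists_eq_add_of_le' (show 2 ≤ n by omega)
  obtain ⟨l, rfl⟩ := Nat.exists_eq_add_of_le' hm
  refine ⟨extremal k l, isSymmBil_extremal, psi_extremal_pos, ?_⟩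
  rw [meanCurv_extremal, rhoPerp_extremal, rho_extremal, PiLp.norm_single]
  have := mul_pos hδ (Real.rpow_pos_of_pos (psi_extremal_pos (k := k) (l := l))
    (2 / ((k + 2 : ℕ) : ℝ)))
  refine lt_of_eq_of_lt ?_ this
  norm_num

end Paper
end
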